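/- Let A be a finite-dimensional K-algebra, E a finite-dimensional A-module that is a cogenerator, and Γ = End_A(E)^op. Then P = D E ≅ Hom_A(E, DA) is a faithful projective Γ-module, there exists a P-special tilting Γ-module (unique up to add-equivalence, so there is a unique basic P-special tilting module T_P), and End_Γ(P)^op ≅ A. -/

import Mathlib

/- Preliminary notions: `add`, `gen`, `cogen`, generators and cogenerators,
short exact sequences, basic modules, indecomposability. -/

noncomputable section

namespace GenFinitePaper

open Function

variable (R : Type) [Ring R]

/-- `M` lies in `add X`, i.e. `M` is a direct summand of a finite direct sum of copies of `X`. -/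
def InAdd (X : Type) [AddCommGroup X] [Module R X]
    (M : Type) [AddCommGroup M] [Module R M] : Prop :=
  ∃ (n : ℕ) (i : M →ₗ[R] (Fin n → X)) (p : (Fin n → X) →ₗ[R] M), p.comp i = LinearMap.id

/-- `M` lies in `gen X`, i.e. `M` is an epimorphic image of a module in `add X`. -/
def InGen (X : Type) [AddCommGroup X] [Module R X]
    (M : Type) [AddCommGroup M] [Module R M] : Prop :=
  ∃ (n : ℕ) (p : (Fin n → X) →ₗ[R] M), Surjective p

/-- `M` lies in `cogen X`, i.e. `M` embeds into a module in `add X`. -/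
def InCogen (X : Type) [AddCommGroup X] [Module R X]
    (M : Type) [AddCommGroup M] [Module R M] : Prop :=
  ∃ (n : ℕ) (i : M →ₗ[R] (Fin n → X)), Injective i

/-- `E` is a generator for `mod R`: `R ∈ add E`. -/
def IsGenerator (E : Type) [AddCommGroup E] [Module R E] : Prop :=
  InAdd R E R

/-- `E` is a cogenerator for `mod R`: every finitely generated (equivalently, over a
finite-dimensional algebra, finite-dimensional) module embeds into a module in `add E`. -/
def IsCogenerator (E : Type) [AddCommGroup E] [Module R E] : Prop :=
  ∀ (M : Type) [AddCommGroup M] [Module R M], Module.Finite R M → InCogen R E M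

/-- A short exact sequence `0 → X → Y → Z → 0` of modules, given by a pair of composable
linear maps. -/
def IsShortExact {X Y Z : Type} [AddCommGroup X] [Module R X] [AddCommGroup Y] [Module R Y]
    [AddCommGroup Z] [Module R Z] (f : X →ₗ[R] Y) (g : Y →ₗ[R] Z) : Prop :=
  Injective f ∧ Surjective g ∧ Exact f g

/-- A module is basic if it has no repeated indecomposable direct summands; equivalently
(by Krull--Remak--Schmidt) no nonzero module `X` is such that `X ⊕ X` is a direct summand. -/
def IsBasic (M : Type) [AddCommGroup M] [Module R M] : Prop :=
  ∀ (X Y : Type) [AddCommGroup X] [Module R X] [AddCommGroup Y] [Module R Y],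
    Nonempty (M ≃ₗ[R] ((X × X) × Y)) → Subsingleton X

/-- A module is indecomposable if it is nonzero and admits no nontrivial idempotent
endomorphism. -/
def Indecomposable (M : Type) [AddCommGroup M] [Module R M] : Prop :=
  Nontrivial M ∧ ∀ φ : M →ₗ[R] M, φ.comp φ = φ → φ = 0 ∨ φ = LinearMap.id

end GenFinitePaper
/- K-linear duality: the dual of the regular module, duals of modules over endomorphism
rings, and Hom-modules over endomorphism rings. -/

namespace GenFinitePaper

open Function

variable (K : Type) [Field K]

/-- `D R = Hom_K(R, K)`, the `K`-linear dual of a `K`-algebra `R`, viewed as a left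
`R`-module via `(r • f) x = f (x * r)`. -/
def RegularDual (R : Type) [Ring R] [Algebra K R] : Type := R →ₗ[K] K

namespace RegularDual

variable (R : Type) [Ring R] [Algebra K R]

instance : AddCommGroup (RegularDual K R) := inferInstanceAs (AddCommGroup (R →ₗ[K] K))

instance : Module K (RegularDual K R) := inferInstanceAs (Module K (R →ₗ[K] K))

/-- The action of `R` on its `K`-linear dual, by `(r • f) x = f (x * r)`. -/
def actHom : R →+* Module.End K (R →ₗ[K] K) where
  toFun r := (LinearMap.mulRight K r).lcomp K K
  map_one' := by ext f x; simp
  map_mul' r s := by ext f x; simp [mul_assoc]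
  map_zero' := by ext f x; simp
  map_add' r s := by ext f x; simp [mul_add]

instance : Module R (RegularDual K R) :=
  Module.compHom (R →ₗ[K] K) (actHom K R)

lemma smul_def (r : R) (f : RegularDual K R) :
    r • f = (f : R →ₗ[K] K).comp (LinearMap.mulRight K r) := rfl

end RegularDual

/-- `D M = Hom_K(M, K)`, the `K`-linear dual of a module `M` over a `K`-algebra `R`,
viewed as a left module over `End_R(M)ᵒᵖ` via `(φᵒᵖ • f) = f ∘ φ`. -/
def ModuleDual (R : Type) [Ring R] [Algebra K R] (M : Type) [AddCommGroup M] [Module R M]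
    [Module K M] [IsScalarTower K R M] : Type := M →ₗ[K] K

namespace ModuleDual

variable (R : Type) [Ring R] [Algebra K R] (M : Type) [AddCommGroup M] [Module R M]
  [Module K M] [IsScalarTower K R M]

instance : AddCommGroup (ModuleDual K R M) := inferInstanceAs (AddCommGroup (M →ₗ[K] K))

instance : Module K (ModuleDual K R M) := inferInstanceAs (Module K (M →ₗ[K] K))

/-- The action of `End_R(M)ᵒᵖ` on `Hom_K(M, K)` by precomposition. -/
def actHom : (Module.End R M)ᵐᵒᵖ →+* Module.End K (M →ₗ[K] K) where
  toFun φ := (LinearMap.restrictScalars K φ.unop).lcomp K K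
  map_one' := by ext f x; rfl
  map_mul' φ ψ := by ext f x; rfl
  map_zero' := by ext f x; simp
  map_add' φ ψ := by ext f x; simp

instance : Module (Module.End R M)ᵐᵒᵖ (ModuleDual K R M) :=
  Module.compHom (M →ₗ[K] K) (actHom K R M)

lemma smul_def (φ : (Module.End R M)ᵐᵒᵖ) (f : ModuleDual K R M) :
    φ • f = (f : M →ₗ[K] K).comp (LinearMap.restrictScalars K φ.unop) := rfl

end ModuleDual

/-- `Hom_R(E, N)` viewed as a left module over `Γ = End_R(E)ᵒᵖ` via `(φᵒᵖ • g) = g ∘ φ`. -/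
def HomOp (R : Type) [Ring R] (E : Type) [AddCommGroup E] [Module R E]
    (N : Type) [AddCommGroup N] [Module R N] : Type := E →ₗ[R] N

namespace HomOp

variable (R : Type) [Ring R] (E : Type) [AddCommGroup E] [Module R E]
  (N : Type) [AddCommGroup N] [Module R N]

instance : AddCommGroup (HomOp R E N) := inferInstanceAs (AddCommGroup (E →ₗ[R] N))

/-- The action of `End_R(E)ᵒᵖ` on `Hom_R(E, N)` by precomposition. -/
def actHom : (Module.End R E)ᵐᵒᵖ →+* Module.End ℤ (E →ₗ[R] N) where
  toFun φ :=
    { toFun := fun g => (g : E →ₗ[R] N).comp φ.unop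
      map_add' := fun g h => LinearMap.add_comp _ _ _
      map_smul' := fun n g => LinearMap.smul_comp n g φ.unop }
  map_one' := by ext g x; rfl
  map_mul' φ ψ := by ext g x; rfl
  map_zero' := by ext g x; simp
  map_add' φ ψ := by ext g x; simp

instance : Module (Module.End R E)ᵐᵒᵖ (HomOp R E N) :=
  Module.compHom (E →ₗ[R] N) (actHom R E N)

lemma smul_def (φ : (Module.End R E)ᵐᵒᵖ) (g : HomOp R E N) :
    φ • g = (g : E →ₗ[R] N).comp φ.unop := rfl

end HomOp

end GenFinitePaper
/- Tilting and cotilting modules, and special (co)tilting modules. -/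

namespace GenFinitePaper

open Function

variable (Γ : Type) [Ring Γ]

/-- A (classical) tilting module:
(T1) projective dimension at most 1;
(T2) no self-extensions (every short exact sequence `0 → T → X → T → 0` splits);
(T3) an exact sequence `0 → Γ → T₀ → T₁ → 0` with `T₀, T₁ ∈ add T`. -/
structure IsTilting (T : Type) [AddCommGroup T] [Module Γ T] : Prop where
  pdim_le_one : ∃ (P₁ P₀ : Type) (_ : AddCommGroup P₁) (_ : Module Γ P₁)
      (_ : AddCommGroup P₀) (_ : Module Γ P₀) (f : P₁ →ₗ[Γ] P₀) (g : P₀ →ₗ[Γ] T),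
      Module.Projective Γ P₁ ∧ Module.Projective Γ P₀ ∧ IsShortExact Γ f g
  rigid : ∀ (X : Type) [AddCommGroup X] [Module Γ X], ∀ (f : T →ₗ[Γ] X) (g : X →ₗ[Γ] T),
      IsShortExact Γ f g → ∃ r : X →ₗ[Γ] T, r.comp f = LinearMap.id
  coresolves : ∃ (T₀ T₁ : Type) (_ : AddCommGroup T₀) (_ : Module Γ T₀)
      (_ : AddCommGroup T₁) (_ : Module Γ T₁) (f : Γ →ₗ[Γ] T₀) (g : T₀ →ₗ[Γ] T₁),
      InAdd Γ T T₀ ∧ InAdd Γ T T₁ ∧ IsShortExact Γ f g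

/-- A `P`-special tilting module, for `P` a projective module: a tilting module `T` with
`P ∈ add T` such that the module `T₀` in (T3) can be chosen in `add P`. -/
structure IsSpecialTilting (P : Type) [AddCommGroup P] [Module Γ P]
    (T : Type) [AddCommGroup T] [Module Γ T] : Prop where
  isTilting : IsTilting Γ T
  mem_add : InAdd Γ T P
  coresolves_special : ∃ (T₀ T₁ : Type) (_ : AddCommGroup T₀) (_ : Module Γ T₀)
      (_ : AddCommGroup T₁) (_ : Module Γ T₁) (f : Γ →ₗ[Γ] T₀) (g : T₀ →ₗ[Γ] T₁),
      InAdd Γ P T₀ ∧ InAdd Γ T T₁ ∧ IsShortExact Γ f g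

variable (K : Type) [Field K] [Algebra K Γ]

/-- A (classical) cotilting module:
(C1) injective dimension at most 1;
(C2) no self-extensions;
(C3) an exact sequence `0 → C1 → C0 → DΓ → 0` with `C0, C1 ∈ add C`,
where `DΓ` is the `K`-linear dual of the regular module. -/
structure IsCotilting (C : Type) [AddCommGroup C] [Module Γ C] : Prop where
  idim_le_one : ∃ (I0 I1 : Type) (_ : AddCommGroup I0) (_ : Module Γ I0)
      (_ : AddCommGroup I1) (_ : Module Γ I1) (f : C →ₗ[Γ] I0) (g : I0 →ₗ[Γ] I1),
      Module.Injective Γ I0 ∧ Module.Injective Γ I1 ∧ IsShortExact Γ f g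
  rigid : ∀ (X : Type) [AddCommGroup X] [Module Γ X], ∀ (f : C →ₗ[Γ] X) (g : X →ₗ[Γ] C),
      IsShortExact Γ f g → ∃ r : X →ₗ[Γ] C, r.comp f = LinearMap.id
  resolves : ∃ (C1 C0 : Type) (_ : AddCommGroup C1) (_ : Module Γ C1)
      (_ : AddCommGroup C0) (_ : Module Γ C0) (f : C1 →ₗ[Γ] C0)
      (g : C0 →ₗ[Γ] RegularDual K Γ),
      InAdd Γ C C1 ∧ InAdd Γ C C0 ∧ IsShortExact Γ f g

/-- A `Q`-special cotilting module, for `Q` an injective module: a cotilting module `C` with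
`Q ∈ add C` such that the module `C0` in (C3) can be chosen in `add Q`. -/
structure IsSpecialCotilting (Q : Type) [AddCommGroup Q] [Module Γ Q]
    (C : Type) [AddCommGroup C] [Module Γ C] : Prop where
  isCotilting : IsCotilting Γ K C
  mem_add : InAdd Γ C Q
  resolves_special : ∃ (C1 C0 : Type) (_ : AddCommGroup C1) (_ : Module Γ C1)
      (_ : AddCommGroup C0) (_ : Module Γ C0) (f : C1 →ₗ[Γ] C0)
      (g : C0 →ₗ[Γ] RegularDual K Γ),
      InAdd Γ Q C0 ∧ InAdd Γ C C1 ∧ IsShortExact Γ f g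

end GenFinitePaper

namespace GenFinitePaper

open Function

section AddCategory

variable {R : Type} [Ring R]

/-- `M` is a retract (equivalently, a direct summand) of `N`. -/
def IsRetract (R : Type) [Ring R] (M N : Type) [AddCommGroup M] [Module R M]
    [AddCommGroup N] [Module R N] : Prop :=
  ∃ (i : M →ₗ[R] N) (p : N →ₗ[R] M), ∀ x, p (i x) = x

variable {M N L X Y : Type} [AddCommGroup M] [Module R M] [AddCommGroup N] [Module R N]
  [AddCommGroup L] [Module R L] [AddCommGroup X] [Module R X] [AddCommGroup Y] [Module R Y]

lemma IsRetract.trans (h₁ : IsRetract R M N) (h₂ : IsRetract R N L) : IsRetract R M L := by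
  obtain ⟨i, p, h⟩ := h₁
  obtain ⟨j, q, h'⟩ := h₂
  exact ⟨j.comp i, p.comp q, fun x => by simp [h, h']⟩

lemma IsRetract.of_equiv (e : M ≃ₗ[R] N) : IsRetract R M N :=
  ⟨e, e.symm, fun x => by simp⟩

lemma isRetract_fst : IsRetract R M (M × N) :=
  ⟨LinearMap.inl R M N, LinearMap.fst R M N, fun _ => rfl⟩

lemma isRetract_snd : IsRetract R N (M × N) :=
  ⟨LinearMap.inr R M N, LinearMap.snd R M N, fun _ => rfl⟩

/-- A retract is complemented by the kernel of the retraction. -/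
def retractEquiv (i : M →ₗ[R] N) (p : N →ₗ[R] M) (h : ∀ x, p (i x) = x) :
    N ≃ₗ[R] M × LinearMap.ker p where
  toFun n := (p n, ⟨n - i (p n), by simp [h]⟩)
  map_add' a b := by ext <;> simp; abel
  map_smul' a b := by ext <;> simp [smul_sub]
  invFun x := i x.1 + x.2
  left_inv n := by simp
  right_inv := by rintro ⟨m, k, hk⟩; rw [LinearMap.mem_ker] at hk; ext <;> simp [h, hk]

lemma inAdd_of_sum {ι : Type} [Fintype ι] (i : ι → M →ₗ[R] X) (p : ι → X →ₗ[R] M)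
    (h : ∀ x, ∑ k, p k (i k x) = x) : InAdd R X M := by
  let e := Fintype.equivFin ι
  refine ⟨Fintype.card ι, LinearMap.pi fun k => i (e.symm k),
    ∑ k, (p (e.symm k)).comp (LinearMap.proj k), LinearMap.ext fun x => ?_⟩
  simp only [LinearMap.comp_apply, LinearMap.sum_apply, LinearMap.proj_apply, LinearMap.pi_apply,
    LinearMap.id_apply]
  exact (e.symm.sum_comp fun k => p k (i k x)).trans (h x)

lemma InAdd.exists_sum (h : InAdd R X M) : ∃ (n : ℕ) (i : Fin n → M →ₗ[R] X)
    (p : Fin n → X →ₗ[R] M), ∀ x, ∑ k, p k (i k x) = x := by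
  obtain ⟨n, i, p, h⟩ := h
  refine ⟨n, fun k => (LinearMap.proj k).comp i, fun k => p.comp (LinearMap.single R (fun _ => X) k),
    fun x => ?_⟩
  have := LinearMap.congr_fun h x
  simp only [LinearMap.comp_apply, LinearMap.id_apply] at this ⊢
  rw [← map_sum]
  convert this using 2
  exact LinearMap.sum_single_apply (fun _ : Fin n => X) (i x)

lemma IsRetract.inAdd (h : IsRetract R M X) : InAdd R X M := by
  obtain ⟨i, p, h⟩ := h
  exact inAdd_of_sum (ι := Unit) (fun _ => i) (fun _ => p) (by simpa using h)

lemma InAdd.trans (h₁ : InAdd R Y X) (h₂ : InAdd R X M) : InAdd R Y M := by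
  obtain ⟨n, i, p, h⟩ := h₁.exists_sum
  obtain ⟨m, j, q, h'⟩ := h₂.exists_sum
  refine inAdd_of_sum (ι := Fin m × Fin n) (fun k => (i k.2).comp (j k.1))
    (fun k => (q k.1).comp (p k.2)) fun x => ?_
  simp [Fintype.sum_prod_type, ← map_sum, h, h']

lemma InAdd.prod (h₁ : InAdd R X M) (h₂ : InAdd R X N) : InAdd R X (M × N) := by
  obtain ⟨n, i, p, h⟩ := h₁.exists_sum
  obtain ⟨m, j, q, h'⟩ := h₂.exists_sum
  refine inAdd_of_sum (ι := Fin n ⊕ Fin m)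
    (Sum.elim (fun k => (i k).comp (LinearMap.fst R M N)) fun k => (j k).comp (LinearMap.snd R M N))
    (Sum.elim (fun k => (LinearMap.inl R M N).comp (p k)) fun k => (LinearMap.inr R M N).comp (q k))
    fun x => ?_
  simp only [Fintype.sum_sum_type, Sum.elim_inl, Sum.elim_inr, LinearMap.comp_apply, ← map_sum,
    LinearMap.fst_apply, LinearMap.snd_apply, h, h']
  simp

lemma inAdd_pi (n : ℕ) : InAdd R X (Fin n → X) :=
  ⟨n, LinearMap.id, LinearMap.id, rfl⟩

lemma InAdd.finite (h : InAdd R X M) [Module.Finite R X] : Module.Finite R M := by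
  obtain ⟨n, i, p, h⟩ := h
  exact Module.Finite.of_surjective p fun x => ⟨i x, LinearMap.congr_fun h x⟩

lemma InAdd.projective (h : InAdd R X M) [Module.Projective R X] : Module.Projective R M := by
  obtain ⟨n, i, p, h⟩ := h
  have : Module.Projective R (Fin n → X) :=
    .of_equiv' (DirectSum.linearEquivFunOnFintype R (Fin n) fun _ => X)
  exact Module.Projective.of_split i p h

end AddCategory

section KrullSchmidt

variable {R : Type} [Ring R] {M N X Y T : Type} [AddCommGroup M] [Module R M] [AddCommGroup N]
  [Module R N] [AddCommGroup X] [Module R X] [AddCommGroup Y] [Module R Y]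
  [AddCommGroup T] [Module R T]

lemma IsRetract.isNoetherian (h : IsRetract R M N) [IsNoetherian R N] : IsNoetherian R M := by
  obtain ⟨i, p, h⟩ := h
  exact isNoetherian_of_surjective p (LinearMap.range_eq_top.2 fun x => ⟨i x, h x⟩)

lemma IsRetract.isArtinian (h : IsRetract R M N) [IsArtinian R N] : IsArtinian R M := by
  obtain ⟨i, p, h⟩ := h
  exact isArtinian_of_surjective _ p fun x => ⟨i x, h x⟩

/-- The endomorphism ring of an indecomposable module of finite length is local. -/
lemma Indecomposable.isLocalRing_end [IsNoetherian R X] [IsArtinian R X]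
    (h : Indecomposable R X) : IsLocalRing (Module.End R X) := by
  have := h.1
  refine { isUnit_or_isUnit_of_add_one := fun {a b} hab => ?_ }
  obtain ⟨n, hc, hn⟩ := (a.eventually_isCompl_ker_pow_range_pow.and
    (Filter.eventually_gt_atTop 0)).exists
  have hidem : (Submodule.projection _ _ hc).comp (Submodule.projection _ _ hc) =
      Submodule.projection _ _ hc := (Submodule.isIdempotentElem_projection hc)
  rcases h.2 _ hidem with h0 | h1
  · left
    have hker : LinearMap.ker (a ^ n) = ⊥ := by
      rw [← Submodule.range_projection hc, h0, LinearMap.range_zero]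
    have hran : LinearMap.range (a ^ n) = ⊤ := by
      rw [← Submodule.ker_projection hc, h0, LinearMap.ker_zero]
    have hu : IsUnit (a ^ n) := (Module.End.isUnit_iff _).2
      ⟨LinearMap.ker_eq_bot.1 hker, LinearMap.range_eq_top.1 hran⟩
    exact (isUnit_pow_iff hn.ne').1 hu
  · right
    have hran : LinearMap.range (a ^ n) = ⊥ := by
      rw [← Submodule.ker_projection hc, h1, LinearMap.ker_id]
    have hnil : IsNilpotent a := ⟨n, LinearMap.range_eq_bot.1 hran⟩
    rw [← eq_sub_iff_add_eq'] at hab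
    exact hab ▸ hnil.isUnit_one_sub

lemma isRetract_of_isUnit_comp (i : X →ₗ[R] M) (p : M →ₗ[R] X)
    (h : IsUnit (p.comp i : Module.End R X)) : IsRetract R X M := by
  obtain ⟨u, hu⟩ := h
  refine ⟨i, ((u⁻¹ : (Module.End R X)ˣ) : Module.End R X).comp p, fun x => ?_⟩
  have := LinearMap.congr_fun u.inv_mul x
  rw [hu] at this
  exact this

lemma Indecomposable.isRetract_of_inAdd [IsNoetherian R X] [IsArtinian R X]
    (hX : Indecomposable R X) (h : InAdd R M X) : IsRetract R X M := by
  have := hX.isLocalRing_end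
  obtain ⟨n, i, p, h⟩ := h.exists_sum
  have hsum : IsUnit (∑ k, ((p k).comp (i k) : Module.End R X)) := by
    have : ∑ k, ((p k).comp (i k) : Module.End R X) = 1 := by ext x; simp [h]
    exact this ▸ isUnit_one
  by_contra! hcon
  have hall : ∀ k, ((p k).comp (i k) : Module.End R X) ∈ nonunits (Module.End R X) :=
    fun k hu => hcon (isRetract_of_isUnit_comp _ _ hu)
  have key : ∀ s : Finset (Fin n),
      ∑ k ∈ s, ((p k).comp (i k) : Module.End R X) ∈ nonunits (Module.End R X) := by
    intro s
    induction s using Finset.induction_on with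
    | empty => simp
    | insert k s hk ih => rw [Finset.sum_insert hk]; exact IsLocalRing.nonunits_add (hall k) ih
  exact key _ hsum

lemma Indecomposable.isRetract_or_of_prod [IsNoetherian R X] [IsArtinian R X]
    (hX : Indecomposable R X) (h : IsRetract R X (M × N)) :
    IsRetract R X M ∨ IsRetract R X N := by
  have := hX.isLocalRing_end
  obtain ⟨i, p, h⟩ := h
  have hsum : ((p.comp (LinearMap.inl R M N)).comp ((LinearMap.fst R M N).comp i) :
      Module.End R X) + (p.comp (LinearMap.inr R M N)).comp ((LinearMap.snd R M N).comp i) = 1 := by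
    ext x
    simp [← map_add, h]
  exact (IsLocalRing.isUnit_or_isUnit_of_add_one hsum).imp
    (isRetract_of_isUnit_comp _ _) (isRetract_of_isUnit_comp _ _)

lemma Indecomposable.nonempty_equiv_of_isRetract [Nontrivial X] (hY : Indecomposable R Y)
    (h : IsRetract R X Y) : Nonempty (X ≃ₗ[R] Y) := by
  obtain ⟨i, p, h⟩ := h
  rcases hY.2 (i.comp p) (by ext; simp [h]) with h0 | h1
  · obtain ⟨x, hx⟩ := exists_ne (0 : X)
    refine absurd ?_ hx
    have := LinearMap.congr_fun h0 (i x)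
    simp only [LinearMap.comp_apply, h, LinearMap.zero_apply] at this
    rw [← h x, this, map_zero]
  · exact ⟨LinearEquiv.ofLinearMap i p h1 (by ext; simp [h])⟩

lemma length_lt_of_equiv_prod [IsNoetherian R T] [IsArtinian R T] [Nontrivial X]
    (e : T ≃ₗ[R] X × Y) : Module.length R Y < Module.length R T := by
  have hY : IsRetract R Y T := isRetract_snd.trans (.of_equiv e.symm)
  have := hY.isNoetherian
  have := hY.isArtinian
  rw [e.length_eq, Module.length_prod]
  have h1 : 0 < Module.length R X := Module.length_pos
  have h2 : Module.length R Y ≠ ⊤ := Module.length_ne_top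
  conv_lhs => rw [← zero_add (Module.length R Y)]
  exact ENat.add_lt_add_of_lt_of_le h2 h1 le_rfl

lemma exists_indecomposable_isRetract_aux (l : ℕ∞) : ∀ (T : Type) [AddCommGroup T] [Module R T]
    [IsNoetherian R T] [IsArtinian R T] [Nontrivial T], Module.length R T = l →
    ∃ (X : Type) (_ : AddCommGroup X) (_ : Module R X), Indecomposable R X ∧ IsRetract R X T := by
  induction l using WellFoundedLT.induction with
  | ind l ih =>
    rintro T _ _ _ _ _ rfl
    by_cases hT : Indecomposable R T
    · exact ⟨T, _, _, hT, .of_equiv (.refl R T)⟩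
    · simp only [Indecomposable, not_and, not_forall, not_or] at hT
      obtain ⟨φ, hφ, h0, h1⟩ := hT inferInstance
      have hφ' : ∀ x, φ (φ x) = φ x := fun x => LinearMap.congr_fun hφ x
      have hret : IsRetract R (LinearMap.range φ) T :=
        ⟨Submodule.subtype _, φ.rangeRestrict, by rintro ⟨_, y, rfl⟩; ext; simp [hφ']⟩
      have hne : LinearMap.range φ ≠ ⊤ := fun h => h1 <| by
        ext x
        obtain ⟨y, rfl⟩ := LinearMap.range_eq_top.1 h x
        simp [hφ']
      have : Nontrivial (LinearMap.range φ) :=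
        Submodule.nontrivial_iff_ne_bot.2 fun h => h0 (LinearMap.range_eq_bot.1 h)
      obtain ⟨X, _, _, hX, hXr⟩ := ih _ (Submodule.length_lt hne) (LinearMap.range φ) rfl
      exact ⟨X, _, _, hX, hXr.trans hret⟩

/-- A nonzero module of finite length has an indecomposable direct summand. -/
lemma exists_indecomposable_isRetract [IsNoetherian R T] [IsArtinian R T] [Nontrivial T] :
    ∃ (X : Type) (_ : AddCommGroup X) (_ : Module R X), Indecomposable R X ∧ IsRetract R X T :=
  exists_indecomposable_isRetract_aux _ T rfl

lemma IsBasic.isRetract_aux (l : ℕ∞) : ∀ (T M : Type) [AddCommGroup T] [Module R T]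
    [AddCommGroup M] [Module R M] [IsNoetherian R T] [IsArtinian R T], Module.length R T = l →
    IsBasic R T →
    (∀ (X : Type) [AddCommGroup X] [Module R X], Indecomposable R X → IsRetract R X T →
      IsRetract R X M) → IsRetract R T M := by
  induction l using WellFoundedLT.induction with
  | ind l ih =>
    rintro T M _ _ _ _ _ _ rfl hb hret
    rcases subsingleton_or_nontrivial T with hT | hT
    · exact ⟨(0 : T →ₗ[R] M), (0 : M →ₗ[R] T), fun x => Subsingleton.elim _ _⟩
    obtain ⟨X, _, _, hX, hXT⟩ := exists_indecomposable_isRetract (R := R) (T := T)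
    have := hX.1
    obtain ⟨j, q, hjq⟩ := hret X hX hXT
    obtain ⟨i, p, hip⟩ := hXT
    let eT := retractEquiv i p hip
    let eM := retractEquiv j q hjq
    have hKT : IsRetract R (LinearMap.ker p) T := isRetract_snd.trans (.of_equiv eT.symm)
    have hbK : IsBasic R (LinearMap.ker p) := by
      rintro Z W _ _ _ _ ⟨e⟩
      let e₁ : (X × LinearMap.ker p) ≃ₗ[R] LinearMap.ker p × X := LinearEquiv.prodComm R _ _
      let e₂ : (LinearMap.ker p × X) ≃ₗ[R] ((Z × Z) × W) × X := e.prodCongr (.refl R X)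
      exact hb Z (W × X) ⟨((eT.trans e₁).trans e₂).trans (LinearEquiv.prodAssoc R _ _ _)⟩
    have hK := ih _ (length_lt_of_equiv_prod eT) (LinearMap.ker p) (LinearMap.ker q) rfl hbK
      fun Z _ _ hZ hZK => by
        have := hKT.isNoetherian
        have := hKT.isArtinian
        have := hZK.isNoetherian
        have := hZK.isArtinian
        rcases hZ.isRetract_or_of_prod ((hret Z hZ (hZK.trans hKT)).trans (.of_equiv eM)) with h | h
        · have := hZ.1
          obtain ⟨e⟩ := hX.nonempty_equiv_of_isRetract h
          obtain ⟨i', p', h'⟩ := hZK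
          have := hb X (LinearMap.ker p') ⟨eT.trans <|
            (((LinearEquiv.refl R X).prodCongr
              ((retractEquiv i' p' h').trans (e.prodCongr (.refl R _)))).trans
              (LinearEquiv.prodAssoc R X X _).symm)⟩
          exact absurd this (not_subsingleton X)
        · exact h
    obtain ⟨a, b, hab⟩ := hK
    exact (IsRetract.of_equiv eT).trans <| .trans
      ⟨LinearMap.prodMap .id a, LinearMap.prodMap .id b, fun x => by ext <;> simp [hab]⟩
      (.of_equiv eM.symm)

/-- A basic module of finite length lying in `add M` is a direct summand of `M`. -/
lemma IsBasic.isRetract [IsNoetherian R T] [IsArtinian R T] (hb : IsBasic R T)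
    (h : InAdd R M T) : IsRetract R T M :=
  IsBasic.isRetract_aux _ T M rfl hb fun _ _ _ hX hXT =>
    have := hXT.isNoetherian
    have := hXT.isArtinian
    hX.isRetract_of_inAdd (h.trans hXT.inAdd)

/-- Add-equivalent basic modules of finite length are isomorphic. -/
lemma IsBasic.nonempty_equiv [IsNoetherian R T] [IsArtinian R T] [IsNoetherian R M]
    [IsArtinian R M] (hT : IsBasic R T) (hM : IsBasic R M)
    (h : InAdd R M T) (h' : InAdd R T M) : Nonempty (T ≃ₗ[R] M) := by
  obtain ⟨i, p, hip⟩ := hT.isRetract h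
  obtain ⟨j, q, hjq⟩ := hM.isRetract h'
  have hi : Injective i := LeftInverse.injective hip
  have hj : Injective j := LeftInverse.injective hjq
  have hs : Surjective (i.comp j) :=
    IsArtinian.surjective_of_injective_endomorphism (i.comp j) (hi.comp hj)
  exact ⟨LinearEquiv.ofBijective i ⟨hi, fun y => (hs y).imp' j fun _ h => h⟩⟩

lemma exists_isBasic_aux (l : ℕ∞) : ∀ (U : Type) [AddCommGroup U] [Module R U]
    [IsNoetherian R U] [IsArtinian R U], Module.length R U = l →
    ∃ (T : Type) (_ : AddCommGroup T) (_ : Module R T),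
      IsBasic R T ∧ InAdd R U T ∧ InAdd R T U := by
  induction l using WellFoundedLT.induction with
  | ind l ih =>
    rintro U _ _ _ _ rfl
    by_cases hU : IsBasic R U
    · have := (IsRetract.of_equiv (.refl R U)).inAdd
      exact ⟨U, _, _, hU, this, this⟩
    · simp only [IsBasic, not_forall, not_subsingleton_iff_nontrivial] at hU
      obtain ⟨X, Y, _, _, _, _, ⟨e⟩, _⟩ := hU
      have hlt := length_lt_of_equiv_prod (e.trans (LinearEquiv.prodAssoc R X X Y))
      have hr : IsRetract R (X × Y) U :=
        isRetract_snd.trans (.of_equiv (e.trans (LinearEquiv.prodAssoc R X X Y)).symm)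
      have := hr.isNoetherian
      have := hr.isArtinian
      obtain ⟨T, _, _, hb, h1, h2⟩ := ih _ hlt (X × Y) rfl
      have hX : InAdd R (X × Y) X := isRetract_fst.inAdd
      have hY : InAdd R (X × Y) Y := isRetract_snd.inAdd
      exact ⟨T, _, _, hb, hr.inAdd.trans h1,
        h2.trans (((hX.prod hX).prod hY).trans (IsRetract.of_equiv e).inAdd)⟩

/-- Every module of finite length is add-equivalent to a basic module. -/
lemma exists_isBasic (U : Type) [AddCommGroup U] [Module R U] [IsNoetherian R U]
    [IsArtinian R U] : ∃ (T : Type) (_ : AddCommGroup T) (_ : Module R T),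
      IsBasic R T ∧ InAdd R U T ∧ InAdd R T U :=
  exists_isBasic_aux _ U rfl

end KrullSchmidt

section Extensions

variable {R : Type} [Ring R]

/-- Every map from the source of `f` to `L` extends along `f`. -/
def ExtendsAlong {Q₁ Q₀ : Type} [AddCommGroup Q₁] [Module R Q₁] [AddCommGroup Q₀] [Module R Q₀]
    (f : Q₁ →ₗ[R] Q₀) (L : Type) [AddCommGroup L] [Module R L] : Prop :=
  ∀ h : Q₁ →ₗ[R] L, ∃ k : Q₀ →ₗ[R] L, ∀ x, k (f x) = h x

/-- Vanishing of `Ext¹(M, L)`: maps out of `M` lift along epimorphisms with kernel `L`. -/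
def ExtVanishes (R : Type) [Ring R] (M L : Type) [AddCommGroup M] [Module R M]
    [AddCommGroup L] [Module R L] : Prop :=
  ∀ (X Y : Type) [AddCommGroup X] [Module R X] [AddCommGroup Y] [Module R Y]
    (a : L →ₗ[R] X) (b : X →ₗ[R] Y), IsShortExact R a b →
    ∀ h : M →ₗ[R] Y, ∃ h' : M →ₗ[R] X, ∀ x, b (h' x) = h x

variable {M L N X Q₁ Q₀ T : Type} [AddCommGroup M] [Module R M] [AddCommGroup L] [Module R L]
  [AddCommGroup N] [Module R N] [AddCommGroup X] [Module R X] [AddCommGroup T] [Module R T]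
  [AddCommGroup Q₁] [Module R Q₁] [AddCommGroup Q₀] [Module R Q₀]

lemma IsShortExact.exists_retraction_iff {f : L →ₗ[R] X} {g : X →ₗ[R] M}
    (h : IsShortExact R f g) :
    (∃ r : X →ₗ[R] L, r.comp f = LinearMap.id) ↔ ∃ s : M →ₗ[R] X, g.comp s = LinearMap.id :=
  (h.2.2.split_tfae h.1 h.2.1).out 1 0

lemma extVanishes_of_splits
    (hT : ∀ (X : Type) [AddCommGroup X] [Module R X], ∀ (f : L →ₗ[R] X) (g : X →ₗ[R] M),
      IsShortExact R f g → ∃ r : X →ₗ[R] L, r.comp f = LinearMap.id) :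
    ExtVanishes R M L := by
  intro X Y _ _ _ _ a b hab h
  let W := LinearMap.ker (b.comp (LinearMap.fst R X M) - h.comp (LinearMap.snd R X M))
  have hW : ∀ w : W, b w.1.1 = h w.1.2 := fun w =>
    sub_eq_zero.1 (LinearMap.mem_ker.1 w.2)
  let f : L →ₗ[R] W := ((LinearMap.inl R X M).comp a).codRestrict W fun x => by
    simp [W, hab.2.2.apply_apply_eq_zero]
  let g : W →ₗ[R] M := (LinearMap.snd R X M).comp W.subtype
  have hfg : IsShortExact R f g := by
    refine ⟨fun x y hxy => hab.1 (congrArg (fun w : W => w.1.1) hxy), fun m => ?_, fun w => ?_⟩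
    · obtain ⟨x, hx⟩ := hab.2.1 (h m)
      exact ⟨⟨(x, m), by simp [W, hx]⟩, rfl⟩
    · constructor
      · intro hw
        have hw : w.1.2 = 0 := hw
        have := hW w
        rw [hw, map_zero] at this
        obtain ⟨l, hl⟩ := (hab.2.2 _).1 this
        exact ⟨l, Subtype.ext (Prod.ext hl hw.symm)⟩
      · rintro ⟨l, rfl⟩
        rfl
  obtain ⟨s, hs⟩ := hfg.exists_retraction_iff.1 (hT W f g hfg)
  refine ⟨(LinearMap.fst R X M).comp (W.subtype.comp s), fun x => ?_⟩
  have := LinearMap.congr_fun hs x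
  exact (hW (s x)).trans (congrArg h this)

lemma ExtVanishes.splits (hT : ExtVanishes R M L) {f : L →ₗ[R] X} {g : X →ₗ[R] M}
    (h : IsShortExact R f g) : ∃ r : X →ₗ[R] L, r.comp f = LinearMap.id := by
  obtain ⟨s, hs⟩ := hT X M f g h LinearMap.id
  exact h.exists_retraction_iff.2 ⟨s, LinearMap.ext hs⟩

lemma ExtVanishes.of_inAdd (h : ExtVanishes R M L) (hN : InAdd R M N) : ExtVanishes R N L := by
  intro X Y _ _ _ _ a b hab φ
  obtain ⟨n, i, p, hip⟩ := hN.exists_sum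
  choose ψ hψ using fun k => h X Y a b hab (φ.comp (p k))
  refine ⟨∑ k, (ψ k).comp (i k), fun x => ?_⟩
  simp only [LinearMap.sum_apply, LinearMap.comp_apply, map_sum, hψ]
  rw [← map_sum, hip]

lemma extVanishes_of_projective [Module.Projective R M] : ExtVanishes R M L :=
  fun _ _ _ _ _ _ _ b hab h =>
    (Module.projective_lifting_property b h hab.2.1).imp fun _ e => LinearMap.congr_fun e

lemma ExtVanishes.prod (hM : ExtVanishes R M L) (hN : ExtVanishes R N L) :
    ExtVanishes R (M × N) L := by
  intro X Y _ _ _ _ a b hab φ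
  obtain ⟨α, hα⟩ := hM X Y a b hab (φ.comp (.inl R M N))
  obtain ⟨β, hβ⟩ := hN X Y a b hab (φ.comp (.inr R M N))
  refine ⟨α.coprod β, fun x => ?_⟩
  simp only [LinearMap.coprod_apply, map_add, hα, hβ, LinearMap.comp_apply]
  simp [← map_add]

lemma ExtVanishes.extendsAlong (h : ExtVanishes R M L) {f : Q₁ →ₗ[R] Q₀} {g : Q₀ →ₗ[R] M}
    (hfg : IsShortExact R f g) : ExtendsAlong f L := by
  intro φ
  let W := LinearMap.range (φ.prod (-f))
  let a : L →ₗ[R] (L × Q₀) ⧸ W := W.mkQ.comp (.inl R L Q₀)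
  let b : ((L × Q₀) ⧸ W) →ₗ[R] M := W.liftQ (g.comp (.snd R L Q₀)) <| by
    rintro _ ⟨q, rfl⟩
    simp [hfg.2.2.apply_apply_eq_zero]
  have hW : ∀ q, W.mkQ (0, f q) = W.mkQ (φ q, 0) := fun q => by
    rw [eq_comm, ← sub_eq_zero, ← map_sub]
    exact (Submodule.Quotient.mk_eq_zero W).2 ⟨q, by simp⟩
  have hab : IsShortExact R a b := by
    refine ⟨?_, fun m => ?_, fun w => ?_⟩
    · refine (injective_iff_map_eq_zero a).2 fun l hl => ?_
      obtain ⟨q, hq⟩ := (Submodule.Quotient.mk_eq_zero W).1 hl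
      have h2 : -f q = 0 := congrArg Prod.snd hq
      have h1 : φ q = l := congrArg Prod.fst hq
      rw [neg_eq_zero, ← map_zero f] at h2
      rw [← h1, hfg.1 h2, map_zero]
    · obtain ⟨x, rfl⟩ := hfg.2.1 m
      exact ⟨W.mkQ (0, x), rfl⟩
    · obtain ⟨⟨l, x⟩, rfl⟩ := W.mkQ_surjective w
      constructor
      · intro hx
        obtain ⟨q, rfl⟩ := (hfg.2.2 x).1 hx
        refine ⟨l + φ q, ?_⟩
        have : ((l, f q) : L × Q₀) = (l, 0) + (0, f q) := by simp
        rw [this, map_add W.mkQ, hW, map_add a]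
        rfl
      · rintro ⟨l', hl'⟩
        rw [← hl']
        exact map_zero g
  obtain ⟨r, hr⟩ := h.splits hab
  refine ⟨r.comp (W.mkQ.comp (.inr R L Q₀)), fun q => ?_⟩
  exact (congrArg r (hW q)).trans (LinearMap.congr_fun hr (φ q))

lemma ExtendsAlong.extVanishes [Module.Projective R Q₀] {f : Q₁ →ₗ[R] Q₀} {g : Q₀ →ₗ[R] M}
    (h : ExtendsAlong f L) (hfg : IsShortExact R f g) : ExtVanishes R M L := by
  refine extVanishes_of_splits fun X _ _ a b hab => hab.exists_retraction_iff.2 ?_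
  obtain ⟨γ, hγ⟩ := Module.projective_lifting_property b g hab.2.1
  have hγ : ∀ x, b (γ x) = g x := LinearMap.congr_fun hγ
  have hmem : ∀ q, γ (f q) ∈ LinearMap.range a := fun q =>
    (hab.2.2 _).1 (by rw [hγ, hfg.2.2.apply_apply_eq_zero])
  let e := LinearEquiv.ofInjective a hab.1
  obtain ⟨k, hk⟩ := h (e.symm.toLinearMap.comp ((γ.comp f).codRestrict _ hmem))
  have hk' : ∀ q, a (k (f q)) = γ (f q) := fun q => by
    rw [hk]
    exact congrArg Subtype.val (e.apply_symm_apply ⟨γ (f q), hmem q⟩)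
  have hker : LinearMap.ker g ≤ LinearMap.ker (γ - a.comp k) := fun x hx => by
    obtain ⟨q, rfl⟩ := (hfg.2.2 x).1 hx
    simp [hk']
  let s := (LinearMap.ker g).liftQ (γ - a.comp k) hker
  refine ⟨s.comp (g.quotKerEquivOfSurjective hfg.2.1).symm.toLinearMap, LinearMap.ext fun m => ?_⟩
  obtain ⟨x, rfl⟩ := hfg.2.1 m
  have : (g.quotKerEquivOfSurjective hfg.2.1).symm (g x) = (LinearMap.ker g).mkQ x := by
    rw [LinearEquiv.symm_apply_eq]
    rfl
  simp [this, s, hγ, hab.2.2.apply_apply_eq_zero]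

lemma ExtendsAlong.of_inAdd {f : Q₁ →ₗ[R] Q₀} (h : ExtendsAlong f L) (hN : InAdd R L N) :
    ExtendsAlong f N := by
  intro φ
  obtain ⟨n, i, p, hip⟩ := hN.exists_sum
  choose ψ hψ using fun k => h ((i k).comp φ)
  refine ⟨∑ k, (p k).comp (ψ k), fun x => ?_⟩
  simp [hψ, hip]

lemma ExtendsAlong.of_surjective [Module.Projective R Q₁] {f : Q₁ →ₗ[R] Q₀}
    (h : ExtendsAlong f L) (p : L →ₗ[R] N) (hp : Surjective p) : ExtendsAlong f N := by
  intro φ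
  obtain ⟨ψ, hψ⟩ := Module.projective_lifting_property p φ hp
  obtain ⟨k, hk⟩ := h ψ
  exact ⟨p.comp k, fun x => by simp [hk, ← hψ]⟩

variable (R) in
/-- `M` has projective dimension at most one. -/
def PdimLeOne (M : Type) [AddCommGroup M] [Module R M] : Prop :=
  ∃ (P₁ P₀ : Type) (_ : AddCommGroup P₁) (_ : Module R P₁)
      (_ : AddCommGroup P₀) (_ : Module R P₀) (f : P₁ →ₗ[R] P₀) (g : P₀ →ₗ[R] M),
      Module.Projective R P₁ ∧ Module.Projective R P₀ ∧ IsShortExact R f g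

lemma PdimLeOne.pi (h : PdimLeOne R M) (n : ℕ) : PdimLeOne R (Fin n → M) := by
  obtain ⟨P₁, P₀, _, _, _, _, f, g, h₁, h₀, hfg⟩ := h
  refine ⟨Fin n → P₁, Fin n → P₀, _, _, _, _, f.compLeft (Fin n), g.compLeft (Fin n),
    (inAdd_pi n).projective, (inAdd_pi n).projective, ?_, ?_, ?_⟩
  · exact hfg.1.comp_left
  · exact hfg.2.1.comp_left
  · intro x
    constructor
    · intro hx
      choose y hy using fun k => (hfg.2.2 (x k)).1 (congrFun hx k)
      exact ⟨y, funext hy⟩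
    · rintro ⟨y, rfl⟩
      exact funext fun k => hfg.2.2.apply_apply_eq_zero (y k)

lemma PdimLeOne.of_isRetract (h : PdimLeOne R N) (hM : IsRetract R M N) : PdimLeOne R M := by
  obtain ⟨P₁, P₀, _, _, _, _, f, π, h₁, h₀, hfg⟩ := h
  obtain ⟨i, p, hip⟩ := hM
  let g : (M →₀ R) →ₗ[R] M := Finsupp.linearCombination R id
  have hg : Surjective g := Finsupp.linearCombination_id_surjective R M
  obtain ⟨a, ha⟩ := Module.projective_lifting_property π (i.comp g) hfg.2.1
  obtain ⟨b, hb⟩ := Module.projective_lifting_property g (p.comp π) hg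
  have ha : ∀ x, π (a x) = i (g x) := LinearMap.congr_fun ha
  have hb : ∀ x, g (b x) = p (π x) := LinearMap.congr_fun hb
  let Z := LinearMap.ker g
  have hZ : ∀ z : Z, a z ∈ LinearMap.range f := fun z => by
    refine (hfg.2.2 _).1 ?_
    rw [ha, LinearMap.mem_ker.1 z.2, map_zero]
  let e := LinearEquiv.ofInjective f hfg.1
  let u : Z →ₗ[R] P₁ := e.symm.toLinearMap.comp ((a.comp Z.subtype).codRestrict _ hZ)
  have hu : ∀ z, f (u z) = a z := fun z =>
    congrArg Subtype.val (e.apply_symm_apply ⟨a z, hZ z⟩)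
  let v : P₁ →ₗ[R] Z := (b.comp f).codRestrict Z fun x => by
    simp [Z, hb, hfg.2.2.apply_apply_eq_zero]
  let w : (M →₀ R) →ₗ[R] Z := (LinearMap.id - b.comp a).codRestrict Z fun x => by
    simp [Z, hb, ha, hip]
  have hproj : Module.Projective R Z := by
    refine Module.Projective.of_split (u.prod Z.subtype) (v.coprod w) (LinearMap.ext fun z => ?_)
    ext1
    simp [v, w, hu]
  have hex : Exact Z.subtype g := g.exact_subtype_ker_map
  refine ⟨Z, M →₀ R, inferInstance, inferInstance, inferInstance, inferInstance, Z.subtype, g,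
    hproj, inferInstance, ?_⟩
  exact And.intro Z.injective_subtype (And.intro hg hex)

lemma PdimLeOne.of_inAdd (h : PdimLeOne R N) (hM : InAdd R N M) : PdimLeOne R M := by
  obtain ⟨n, i, p, hip⟩ := hM
  exact (h.pi n).of_isRetract ⟨i, p, LinearMap.congr_fun hip⟩

end Extensions

section SpecialTilting

variable {Γ : Type} [Ring Γ] {P T S U : Type} [AddCommGroup P] [Module Γ P] [AddCommGroup T]
  [Module Γ T] [AddCommGroup S] [Module Γ S] [AddCommGroup U] [Module Γ U]

lemma IsTilting.extVanishes (h : IsTilting Γ T) : ExtVanishes Γ T T :=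
  extVanishes_of_splits h.rigid

/-- Special tilting modules are invariant under add-equivalence. -/
lemma IsSpecialTilting.of_inAdd (h : IsSpecialTilting Γ P U) (h₁ : InAdd Γ U T)
    (h₂ : InAdd Γ T U) : IsSpecialTilting Γ P T := by
  have hco : ∃ (T₀ T₁ : Type) (_ : AddCommGroup T₀) (_ : Module Γ T₀)
      (_ : AddCommGroup T₁) (_ : Module Γ T₁) (f : Γ →ₗ[Γ] T₀) (g : T₀ →ₗ[Γ] T₁),
      InAdd Γ P T₀ ∧ InAdd Γ T T₁ ∧ IsShortExact Γ f g := by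
    obtain ⟨T₀, T₁, _, _, _, _, f, g, hT₀, hT₁, hfg⟩ := h.coresolves_special
    exact ⟨T₀, T₁, _, _, _, _, f, g, hT₀, h₂.trans hT₁, hfg⟩
  refine ⟨⟨PdimLeOne.of_inAdd h.isTilting.pdim_le_one h₁, ?_, ?_⟩, h₂.trans h.mem_add, hco⟩
  · obtain ⟨Q₁, Q₀, _, _, _, _, f, g, hQ₁, hQ₀, hfg⟩ := h.isTilting.pdim_le_one
    have h1 := (h.isTilting.extVanishes.extendsAlong hfg).of_inAdd h₁
    have h2 := (h1.extVanishes hfg).of_inAdd h₁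
    exact fun X _ _ a b hab => h2.splits hab
  · obtain ⟨T₀, T₁, _, _, _, _, f, g, hT₀, hT₁, hfg⟩ := hco
    exact ⟨T₀, T₁, _, _, _, _, f, g, (h₂.trans h.mem_add).trans hT₀, hT₁, hfg⟩

/-- A finite module over which all elements are reached by maps from `T` is generated by `T`. -/
lemma exists_surjective_of_forall_mem_range [Module.Finite Γ S]
    (h : ∀ s : S, ∃ (φ : T →ₗ[Γ] S) (t : T), φ t = s) :
    ∃ (n : ℕ) (p : (Fin n → T) →ₗ[Γ] S), Surjective p := by
  obtain ⟨n, s, hs⟩ := Module.Finite.exists_fin (R := Γ) (M := S)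
  choose φ t ht using fun k => h (s k)
  refine ⟨n, ∑ k, (φ k).comp (LinearMap.proj k), LinearMap.range_eq_top.1 ?_⟩
  rw [eq_top_iff, ← hs, Submodule.span_le]
  rintro _ ⟨k, rfl⟩
  refine ⟨Pi.single k (t k), ?_⟩
  simp only [LinearMap.sum_apply, LinearMap.comp_apply, LinearMap.proj_apply]
  rw [Finset.sum_eq_single k]
  · simp [ht]
  · intro j _ hj
    simp [Pi.single_eq_of_ne hj]
  · simp

/-- If maps `Γ → S` extend along a map `Γ → T`, then `S` is generated by `T`. -/
lemma ExtendsAlong.exists_surjective [Module.Finite Γ S] {f : Γ →ₗ[Γ] T}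
    (h : ExtendsAlong f S) : ∃ (n : ℕ) (p : (Fin n → T) →ₗ[Γ] S), Surjective p := by
  refine exists_surjective_of_forall_mem_range fun s => ?_
  obtain ⟨k, hk⟩ := h (LinearMap.toSpanSingleton Γ S s)
  exact ⟨k, f 1, by simp [hk]⟩

/-- Homomorphisms between finite modules over a finite-dimensional algebra are finitely generated
over the endomorphisms of the source, and over those of the target. -/
lemma exists_fin_hom_generators (K : Type) [Field K] [Algebra K Γ] [Module.Finite K Γ]
    (T S : Type) [AddCommGroup T] [Module Γ T] [AddCommGroup S] [Module Γ S]
    [Module.Finite Γ T] [Module.Finite Γ S] :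
    ∃ (n : ℕ) (s : Fin n → T →ₗ[Γ] S), ∀ φ : T →ₗ[Γ] S, ∃ (c : Fin n → T →ₗ[Γ] T)
      (d : Fin n → S →ₗ[Γ] S), ∀ x, ∑ k, s k (c k x) = φ x ∧ ∑ k, d k (s k x) = φ x := by
  let _ : Module K T := Module.compHom T (algebraMap K Γ)
  let _ : Module K S := Module.compHom S (algebraMap K Γ)
  have : IsScalarTower K Γ T := .of_algebraMap_smul fun _ _ => rfl
  have : IsScalarTower K Γ S := .of_algebraMap_smul fun _ _ => rfl
  have : Module.Finite K T := .trans Γ T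
  have : Module.Finite K S := .trans Γ S
  let res : (T →ₗ[Γ] S) →ₗ[K] (T →ₗ[K] S) := LinearMap.restrictScalarsₗ K Γ T S K
  have : Module.Finite K (T →ₗ[Γ] S) :=
    .of_injective res (LinearMap.restrictScalars_injective K)
  obtain ⟨n, s, hs⟩ := Module.Finite.exists_fin (R := K) (M := T →ₗ[Γ] S)
  refine ⟨n, s, fun φ => ?_⟩
  obtain ⟨c, hc⟩ := (Submodule.mem_span_range_iff_exists_fun K).1
    (hs ▸ Submodule.mem_top : φ ∈ Submodule.span K (Set.range s))
  refine ⟨fun k => c k • LinearMap.id, fun k => c k • LinearMap.id, fun x => ?_⟩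
  rw [← hc]
  simp

/-- Any two special tilting modules lie in each other's additive closure. -/
lemma IsSpecialTilting.inAdd (K : Type) [Field K] [Algebra K Γ] [Module.Finite K Γ]
    [Module.Finite Γ T] [Module.Finite Γ S] [Module.Projective Γ P]
    (hT : IsSpecialTilting Γ P T) (hS : IsSpecialTilting Γ P S) : InAdd Γ T S := by
  obtain ⟨T₀, T₁, _, _, _, _, f, g, hT₀, hT₁, hfg⟩ := hT.coresolves_special
  obtain ⟨S₀, S₁, _, _, _, _, f', g', hS₀, hS₁, hfg'⟩ := hS.coresolves_special
  have : Module.Projective Γ T₀ := hT₀.projective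
  obtain ⟨n, s, hs⟩ := exists_fin_hom_generators (Γ := Γ) K T S
  let p : (Fin n → T) →ₗ[Γ] S := ∑ k, (s k).comp (LinearMap.proj k)
  have hlift : ∀ (N : Type) [AddCommGroup N] [Module Γ N], InAdd Γ T N → ∀ φ : N →ₗ[Γ] S,
      ∃ ψ : N →ₗ[Γ] (Fin n → T), ∀ x, p (ψ x) = φ x := by
    intro N _ _ hN φ
    obtain ⟨m, i, q, hiq⟩ := hN.exists_sum
    choose c _ hc using fun j => hs (φ.comp (q j))
    refine ⟨∑ j, (LinearMap.pi (c j)).comp (i j), fun x => ?_⟩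
    have h1 : ∀ (j : Fin m) (t : T), p (LinearMap.pi (c j) t) = φ (q j t) := fun j t => by
      rw [← LinearMap.comp_apply φ, ← (hc j t).1]
      simp [p]
    simp only [LinearMap.sum_apply, map_sum, LinearMap.comp_apply, h1]
    rw [← map_sum, hiq]
  have hp : Surjective p := by
    obtain ⟨m, q, hq⟩ :=
      ((hS.isTilting.extVanishes.of_inAdd hS₁).extendsAlong hfg').exists_surjective
    obtain ⟨ψ, hψ⟩ := hlift _ ((hT.mem_add.trans hS₀).trans (inAdd_pi m)) q
    exact fun x => (hq x).imp' ψ fun y hy => (hψ y).trans hy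
  have hTf : ExtendsAlong f (Fin n → T) :=
    ((hT.isTilting.extVanishes.of_inAdd hT₁).extendsAlong hfg).of_inAdd (inAdd_pi n)
  have hKf : ExtendsAlong f (LinearMap.ker p) := by
    intro h
    obtain ⟨k, hk⟩ := hTf ((LinearMap.ker p).subtype.comp h)
    have hker : LinearMap.ker g ≤ LinearMap.ker (p.comp k) := fun x hx => by
      obtain ⟨q, rfl⟩ := (hfg.2.2 x).1 hx
      simp [hk]
    let e := g.quotKerEquivOfSurjective hfg.2.1
    let χ : T₁ →ₗ[Γ] S := ((LinearMap.ker g).liftQ (p.comp k) hker).comp e.symm.toLinearMap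
    have hχ : ∀ x, χ (g x) = p (k x) := fun x => by
      have : e.symm (g x) = (LinearMap.ker g).mkQ x := by
        rw [LinearEquiv.symm_apply_eq]
        rfl
      simp [χ, this]
    obtain ⟨χ', hχ'⟩ := hlift T₁ hT₁ χ
    refine ⟨(k - χ'.comp g).codRestrict _ fun x => by simp [hχ', hχ], fun x => ?_⟩
    ext1
    simp [hk, hfg.2.2.apply_apply_eq_zero]
  have : IsNoetherianRing Γ := .of_finite K Γ
  obtain ⟨m, q, hq⟩ := hKf.exists_surjective
  obtain ⟨Q₁, Q₀, _, _, _, _, d, π, hQ₁, hQ₀, hd⟩ := hS.isTilting.pdim_le_one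
  have hS' := (((hS.isTilting.extVanishes.extendsAlong hd).of_inAdd hS.mem_add).of_inAdd
    (hT₀.trans (inAdd_pi m))).of_surjective q hq
  obtain ⟨σ, hσ⟩ := hS'.extVanishes hd _ _ (LinearMap.ker p).subtype p
    ⟨(LinearMap.ker p).injective_subtype, hp, p.exact_subtype_ker_map⟩ LinearMap.id
  exact ⟨n, σ, p, LinearMap.ext hσ⟩

/-- A finite faithful projective module over a finite-dimensional algebra admits a special
tilting module. -/
lemma exists_isSpecialTilting (K : Type) [Field K] [Algebra K Γ] [Module.Finite K Γ]
    [Module.Finite Γ P] [Module.Projective Γ P] [FaithfulSMul Γ P] :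
    ∃ (U : Type) (_ : AddCommGroup U) (_ : Module Γ U),
      Module.Finite Γ U ∧ IsSpecialTilting Γ P U := by
  obtain ⟨n, s, hs⟩ := exists_fin_hom_generators (Γ := Γ) K Γ P
  let f : Γ →ₗ[Γ] (Fin n → P) := LinearMap.pi s
  let C := (Fin n → P) ⧸ LinearMap.range f
  let g : (Fin n → P) →ₗ[Γ] C := (LinearMap.range f).mkQ
  have hfP : ExtendsAlong f P := fun φ => by
    obtain ⟨_, d, hd⟩ := hs φ
    exact ⟨∑ k, (d k).comp (LinearMap.proj k), fun x => by simp [f, ← (hd x).2]⟩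
  have hinj : Injective f := by
    refine (injective_iff_map_eq_zero f).2 fun γ hγ => ?_
    refine FaithfulSMul.eq_of_smul_eq_smul (α := P) fun x => ?_
    obtain ⟨k, hk⟩ := hfP (LinearMap.toSpanSingleton Γ P x)
    have := hk γ
    rw [hγ, map_zero] at this
    simpa using this.symm
  have hgs : Surjective g := Submodule.mkQ_surjective _
  have hfg : IsShortExact Γ f g := ⟨hinj, hgs, LinearMap.exact_map_mkQ_range f⟩
  have : Module.Projective Γ (Fin n → P) := (inAdd_pi n).projective
  have hPP : InAdd Γ P (P × (Fin n → P)) :=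
    (IsRetract.of_equiv (.refl Γ P)).inAdd.prod (inAdd_pi n)
  have hfU : ExtendsAlong f (P × C) := (hfP.of_inAdd hPP).of_surjective
    (LinearMap.prodMap .id g) (surjective_id.prodMap hgs)
  have hext : ExtVanishes Γ (P × C) (P × C) :=
    .prod extVanishes_of_projective (hfU.extVanishes hfg)
  have hP : InAdd Γ (P × C) P := isRetract_fst.inAdd
  have hC : InAdd Γ (P × C) C := isRetract_snd.inAdd
  refine ⟨P × C, _, _, inferInstance, ⟨⟨?_, fun X _ _ a b hab => hext.splits hab, ?_⟩, hP, ?_⟩⟩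
  · refine ⟨Γ, P × (Fin n → P), _, _, _, _, (LinearMap.inr Γ P (Fin n → P)).comp f,
      LinearMap.prodMap .id g, inferInstance, inferInstance, ?_, ?_, ?_⟩
    · exact LinearMap.inr_injective.comp hinj
    · exact surjective_id.prodMap hgs
    · rintro ⟨x, y⟩
      constructor
      · intro hxy
        obtain ⟨γ, rfl⟩ := (hfg.2.2 y).1 (congrArg Prod.snd hxy)
        have hx : x = 0 := congrArg Prod.fst hxy
        exact ⟨γ, Prod.ext hx.symm rfl⟩
      · rintro ⟨γ, hγ⟩
        rw [← hγ]
        exact Prod.ext rfl (hfg.2.2.apply_apply_eq_zero γ)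
  · exact ⟨Fin n → P, C, _, _, _, _, f, g, hP.trans (inAdd_pi n), hC, hfg⟩
  · exact ⟨Fin n → P, C, _, _, _, _, f, g, inAdd_pi n, hC, hfg⟩

end SpecialTilting

section Duality

variable {K A : Type} [Field K] [Ring A] [Algebra K A] {E : Type} [AddCommGroup E] [Module A E]
  [Module K E] [IsScalarTower K A E]

instance : IsScalarTower K A (RegularDual K A) where
  smul_assoc c a h := by
    refine LinearMap.ext (f := (show A →ₗ[K] K from (c • a) • h)) fun x => ?_
    change (show A →ₗ[K] K from h) (x * c • a) = c • (show A →ₗ[K] K from h) (x * a)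
    rw [mul_smul_comm]
    exact map_smul (show A →ₗ[K] K from h) c (x * a)

/-- The `A`-linear map `E → D A` attached to a functional on `E`. -/
def dualHat (f : E →ₗ[K] K) : E →ₗ[A] RegularDual K A where
  toFun e := (f.comp ((LinearMap.toSpanSingleton A E e).restrictScalars K) : A →ₗ[K] K)
  map_add' x y := LinearMap.ext fun a => by
    change f (a • (x + y)) = f (a • x) + f (a • y)
    simp
  map_smul' b x := LinearMap.ext fun a => by
    change f (a • b • x) = f ((a * b) • x)
    rw [mul_smul]

lemma dualHat_apply (f : E →ₗ[K] K) (e : E) (a : A) :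
    (show A →ₗ[K] K from dualHat (A := A) f e) a = f (a • e) := rfl

variable (K A) in
/-- Evaluation at `1` on the dual of the regular module. -/
def evalOne : RegularDual K A →ₗ[K] K := LinearMap.applyₗ (1 : A)

lemma evalOne_dualHat (f : E →ₗ[K] K) (e : E) : evalOne K A (dualHat f e) = f e := by
  change f ((1 : A) • e) = f e
  rw [one_smul]

variable (K A E) in
/-- `D E ≅ Hom_A(E, D A)`. -/
def moduleDualEquivHomOp :
    ModuleDual K A E ≃ₗ[(Module.End A E)ᵐᵒᵖ] HomOp A E (RegularDual K A) where
  toFun f := dualHat f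
  map_add' _ _ := rfl
  map_smul' φ f := LinearMap.ext fun e => LinearMap.ext fun a =>
    congrArg (show E →ₗ[K] K from f) (map_smul φ.unop a e)
  invFun g := (evalOne K A).comp (LinearMap.restrictScalars K (show E →ₗ[A] RegularDual K A from g))
  left_inv f := LinearMap.ext fun e => evalOne_dualHat f e
  right_inv g := LinearMap.ext fun e => LinearMap.ext fun a => by
    let g' : E →ₗ[A] RegularDual K A := g
    change evalOne K A (g' (a • e)) = (show A →ₗ[K] K from g' e) a
    rw [map_smul]
    change (show A →ₗ[K] K from g' e) (1 * a) = _
    rw [one_mul]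

/-- If `E` is a cogenerator, then `D E` has a finite dual basis over `End_A(E)ᵒᵖ`. -/
lemma IsCogenerator.exists_dual_basis [FiniteDimensional K A] (hE : IsCogenerator A E) :
    ∃ (n : ℕ) (i : Fin n → RegularDual K A →ₗ[A] E) (w : Fin n → E →ₗ[K] K),
      ∀ (f : E →ₗ[K] K) (e : E), ∑ j, w j (i j (dualHat f e)) = f e := by
  have : Module.Finite K (RegularDual K A) := inferInstanceAs (Module.Finite K (A →ₗ[K] K))
  have : Module.Finite A (RegularDual K A) := .of_restrictScalars_finite K A _
  obtain ⟨n, i, hi⟩ := hE (RegularDual K A) this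
  obtain ⟨q, hq⟩ := (i.restrictScalars K).exists_leftInverse_of_injective (LinearMap.ker_eq_bot.2 hi)
  refine ⟨n, fun j => (LinearMap.proj j).comp i,
    fun j => ((evalOne K A).comp q).comp (LinearMap.single K (fun _ => E) j), fun f e => ?_⟩
  have h : q (i (dualHat f e)) = dualHat f e := LinearMap.congr_fun hq (dualHat f e)
  simp only [LinearMap.comp_apply, LinearMap.proj_apply, LinearMap.coe_single, ← map_sum]
  rw [LinearMap.sum_single_apply (fun _ : Fin n => E) (i (dualHat f e)), h, evalOne_dualHat]

lemma ModuleDual.sum_smul_eq {n : ℕ} {i : Fin n → RegularDual K A →ₗ[A] E}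
    {w : Fin n → E →ₗ[K] K}
    (h : ∀ (f : E →ₗ[K] K) (e : E), ∑ j, w j (i j (dualHat f e)) = f e)
    (f : ModuleDual K A E) :
    ∑ j, (MulOpposite.op ((i j).comp (dualHat f)) : (Module.End A E)ᵐᵒᵖ) •
      (show ModuleDual K A E from w j) = f := by
  refine LinearMap.ext fun e => Eq.trans ?_ (h f e)
  exact LinearMap.sum_apply Finset.univ
    (fun j => (w j).comp (LinearMap.restrictScalars K ((i j).comp (dualHat f)))) e

lemma IsCogenerator.projective_moduleDual [FiniteDimensional K A] (hE : IsCogenerator A E) :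
    Module.Projective (Module.End A E)ᵐᵒᵖ (ModuleDual K A E) := by
  obtain ⟨n, i, w, h⟩ := hE.exists_dual_basis (K := K)
  let α : ModuleDual K A E →ₗ[(Module.End A E)ᵐᵒᵖ] (Fin n → (Module.End A E)ᵐᵒᵖ) :=
    { toFun := fun f j => MulOpposite.op ((i j).comp (dualHat f))
      map_add' := fun f g => funext fun j => congrArg MulOpposite.op <| LinearMap.ext fun e =>
        map_add (i j) (dualHat (show E →ₗ[K] K from f) e) (dualHat (show E →ₗ[K] K from g) e)
      map_smul' := fun φ f => funext fun j => congrArg MulOpposite.op <| LinearMap.ext fun e =>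
        congrArg (i j) (LinearMap.congr_fun ((moduleDualEquivHomOp K A E).map_smul φ f) e) }
  refine Module.Projective.of_split α
    (∑ j, (LinearMap.toSpanSingleton _ _ (show ModuleDual K A E from w j)).comp
      (LinearMap.proj j)) (LinearMap.ext fun f => ?_)
  refine Eq.trans ?_ (ModuleDual.sum_smul_eq h f)
  rw [LinearMap.comp_apply, LinearMap.sum_apply]
  rfl

lemma faithfulSMul_moduleDual : FaithfulSMul (Module.End A E)ᵐᵒᵖ (ModuleDual K A E) where
  eq_of_smul_eq_smul {φ ψ} h := by
    refine MulOpposite.unop_injective (LinearMap.ext fun e => ?_)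
    rw [← sub_eq_zero]
    refine (Module.forall_dual_apply_eq_zero_iff K _).1 fun f => ?_
    rw [map_sub, sub_eq_zero]
    exact LinearMap.congr_fun (h f) e

variable (K A E) in
/-- The action of `A` on `D E`, by `End_A(E)ᵒᵖ`-linear maps. -/
def toEndModuleDual :
    A →+* (Module.End (Module.End A E)ᵐᵒᵖ (ModuleDual K A E))ᵐᵒᵖ where
  toFun a := MulOpposite.op
    { toFun := fun f => (f : E →ₗ[K] K).comp (Module.toModuleEnd K (S := A) E a)
      map_add' := fun _ _ => rfl
      map_smul' := fun φ f => LinearMap.ext fun e => congrArg (show E →ₗ[K] K from f)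
        (map_smul φ.unop a e) }
  map_one' := by
    refine congrArg MulOpposite.op (LinearMap.ext fun f => LinearMap.ext fun e => ?_)
    exact congrArg (show E →ₗ[K] K from f) (one_smul A e)
  map_mul' a b := by
    refine congrArg MulOpposite.op (LinearMap.ext fun f => LinearMap.ext fun e => ?_)
    exact congrArg (show E →ₗ[K] K from f) (mul_smul a b e)
  map_zero' := by
    refine congrArg MulOpposite.op (LinearMap.ext fun f => LinearMap.ext fun e => ?_)
    exact (congrArg (show E →ₗ[K] K from f) (zero_smul A e)).trans (map_zero _)
  map_add' a b := by
    refine congrArg MulOpposite.op (LinearMap.ext fun f => LinearMap.ext fun e => ?_)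
    exact (congrArg (show E →ₗ[K] K from f) (add_smul a b e)).trans (map_add _ _ _)

lemma IsCogenerator.toEndModuleDual_bijective [FiniteDimensional K A] (hE : IsCogenerator A E) :
    Bijective (toEndModuleDual K A E) := by
  constructor
  · refine (injective_iff_map_eq_zero _).2 fun a ha => ?_
    obtain ⟨n, i, hi⟩ := hE A inferInstance
    have hae : ∀ e : E, a • e = 0 := fun e =>
      (Module.forall_dual_apply_eq_zero_iff K _).1 fun f =>
        LinearMap.congr_fun (LinearMap.congr_fun (congrArg MulOpposite.unop ha)
          (show ModuleDual K A E from f)) e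
    apply hi
    rw [map_zero, ← mul_one a, ← smul_eq_mul, map_smul]
    exact funext fun k => hae _
  · intro θ
    obtain ⟨n, i, w, h⟩ := hE.exists_dual_basis (K := K)
    let θ' : Module.End (Module.End A E)ᵐᵒᵖ (ModuleDual K A E) := θ.unop
    let ψ : (A →ₗ[K] K) →ₗ[K] K := ∑ j, (show E →ₗ[K] K from θ' (w j)).comp
      (show (A →ₗ[K] K) →ₗ[K] E from (i j).restrictScalars K)
    let a : A := (Module.evalEquiv K A).symm ψ
    have ha : ∀ x : A →ₗ[K] K, x a = ψ x := fun x => Module.apply_evalEquiv_symm_apply K A x ψ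
    refine ⟨a, MulOpposite.unop_injective (LinearMap.ext fun f => LinearMap.ext fun e => ?_)⟩
    change (show E →ₗ[K] K from f) (a • e) = (show E →ₗ[K] K from θ' f) e
    rw [← dualHat_apply]
    refine (ha _).trans ?_
    have key : θ' f = ∑ j, (MulOpposite.op ((i j).comp (dualHat f)) : (Module.End A E)ᵐᵒᵖ) •
        θ' (w j) := by
      conv_lhs => rw [← ModuleDual.sum_smul_eq h f, map_sum]
      exact Finset.sum_congr rfl fun j _ => map_smul θ' _ _
    rw [key]
    exact (LinearMap.sum_apply Finset.univ (fun j => (show E →ₗ[K] K from θ' (w j)).comp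
        (show (A →ₗ[K] K) →ₗ[K] E from (i j).restrictScalars K)) (dualHat f e)).trans
      (LinearMap.sum_apply Finset.univ (fun j => (show E →ₗ[K] K from θ' (w j)).comp
        (LinearMap.restrictScalars K ((i j).comp (dualHat f)))) e).symm

lemma finite_end_op [FiniteDimensional K E] : Module.Finite K (Module.End A E)ᵐᵒᵖ := by
  have : Module.Finite K (Module.End A E) :=
    .of_injective (LinearMap.restrictScalarsₗ K A E E K) (LinearMap.restrictScalars_injective K)
  infer_instance

lemma finite_moduleDual [FiniteDimensional K E] :
    Module.Finite (Module.End A E)ᵐᵒᵖ (ModuleDual K A E) := by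
  have : Module.Finite K (ModuleDual K A E) := inferInstanceAs (Module.Finite K (E →ₗ[K] K))
  have : IsScalarTower K (Module.End A E)ᵐᵒᵖ (ModuleDual K A E) :=
    ⟨fun c φ f => LinearMap.ext fun e =>
      map_smul (show E →ₗ[K] K from f) c (φ.unop e)⟩
  exact .of_restrictScalars_finite K (Module.End A E)ᵐᵒᵖ _

end Duality

end GenFinitePaper

namespace GenFinitePaper

/-- Let `A` be a finite-dimensional `K`-algebra, `E` a finite-dimensional
`A`-module which is a cogenerator, and `Γ = End_A(E)ᵒᵖ`.  Then `P = D E ≅ Hom_A(E, DA)` is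
a faithful projective `Γ`-module, there exists a `P`-special tilting `Γ`-module, which is
unique up to add-equivalence (so there is a unique basic `P`-special tilting module
`T_P`), and `End_Γ(P)ᵒᵖ ≅ A`. -/
theorem cogenerator_special_tilting
    (K A : Type) [Field K] [Ring A] [Algebra K A] [FiniteDimensional K A]
    (E : Type) [AddCommGroup E] [Module A E] [Module K E] [IsScalarTower K A E]
    [FiniteDimensional K E]
    (hE : IsCogenerator A E) :
    -- `P = D E` is a faithful projective `Γ`-module
    FaithfulSMul (Module.End A E)ᵐᵒᵖ (ModuleDual K A E) ∧
    Module.Projective (Module.End A E)ᵐᵒᵖ (ModuleDual K A E) ∧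
    -- `D E ≅ Hom_A(E, D A)` as `Γ`-modules
    Nonempty (ModuleDual K A E ≃ₗ[(Module.End A E)ᵐᵒᵖ] HomOp A E (RegularDual K A)) ∧
    -- there is a basic `P`-special tilting module, unique up to add-equivalence
    (∃ (T : Type) (_ : AddCommGroup T) (_ : Module (Module.End A E)ᵐᵒᵖ T),
      Module.Finite (Module.End A E)ᵐᵒᵖ T ∧ IsBasic (Module.End A E)ᵐᵒᵖ T ∧
      IsSpecialTilting (Module.End A E)ᵐᵒᵖ (ModuleDual K A E) T ∧
      ∀ (T' : Type) (_ : AddCommGroup T') (_ : Module (Module.End A E)ᵐᵒᵖ T'),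
        Module.Finite (Module.End A E)ᵐᵒᵖ T' →
        IsSpecialTilting (Module.End A E)ᵐᵒᵖ (ModuleDual K A E) T' →
        (∀ (M : Type) [AddCommGroup M] [Module (Module.End A E)ᵐᵒᵖ M],
            (InAdd (Module.End A E)ᵐᵒᵖ T M ↔ InAdd (Module.End A E)ᵐᵒᵖ T' M)) ∧
          (IsBasic (Module.End A E)ᵐᵒᵖ T' → Nonempty (T ≃ₗ[(Module.End A E)ᵐᵒᵖ] T'))) ∧
    -- `End_Γ(P)ᵒᵖ ≅ A`
    Nonempty ((Module.End (Module.End A E)ᵐᵒᵖ (ModuleDual K A E))ᵐᵒᵖ ≃+* A) := by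
  have := finite_end_op (K := K) (A := A) (E := E)
  have := finite_moduleDual (K := K) (A := A) (E := E)
  have hproj := hE.projective_moduleDual (K := K)
  have hfaith := faithfulSMul_moduleDual (K := K) (A := A) (E := E)
  have : IsArtinianRing (Module.End A E)ᵐᵒᵖ := .of_finite K _
  have : IsNoetherianRing (Module.End A E)ᵐᵒᵖ := .of_finite K _
  refine ⟨hfaith, hproj, ⟨moduleDualEquivHomOp K A E⟩, ?_,
    ⟨(RingEquiv.ofBijective _ hE.toEndModuleDual_bijective).symm⟩⟩
  obtain ⟨U, _, _, _, hU⟩ := exists_isSpecialTilting (Γ := (Module.End A E)ᵐᵒᵖ)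
    (P := ModuleDual K A E) K
  obtain ⟨T, _, _, hb, hUT, hTU⟩ := exists_isBasic (R := (Module.End A E)ᵐᵒᵖ) U
  have hT := hU.of_inAdd hUT hTU
  have := hUT.finite
  refine ⟨T, _, _, inferInstance, hb, hT, fun T' _ _ _ hT' => ?_⟩
  have h₁ := hT.inAdd K hT'
  have h₂ := hT'.inAdd K hT
  exact ⟨fun M _ _ => ⟨h₂.trans, h₁.trans⟩, fun hb' => hb.nonempty_equiv hb' h₂ h₁⟩

end GenFinitePaper
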